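/- arXiv:2302.01852 — 2 statements merged into one kernel-verified Lean document; each statement's English description precedes it below -/
import Mathlib

section
/- Let Φ' be a k-pseudoflower which has a concatenation Φ into a finite k-anemone. Then the union S ∪ R of any petal S of Φ' with any petal R of Φ not containing S has connectivity exactly k−1. -/
open Set

/-- A symmetric set function: `λ(A) = λ(E \ A)`. -/
def SymmFn {E : Type*} (lam : Set E → ℕ∞) : Prop := ∀ A : Set E, lam Aᶜ = lam A

/-- A submodular set function: `λ(A) + λ(B) ≥ λ(A ∪ B) + λ(A ∩ B)`. -/
def SubmodularFn {E : Type*} (lam : Set E → ℕ∞) : Prop :=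
  ∀ A B : Set E, lam (A ∪ B) + lam (A ∩ B) ≤ lam A + lam B

/-- A limit-closed set function: the union of a (nonempty) chain of sets of connectivity at most
`k` again has connectivity at most `k`. -/
def LimitClosedFn {E : Type*} (lam : Set E → ℕ∞) : Prop :=
  ∀ (k : ℕ) (C : Set (Set E)), C.Nonempty → IsChain (· ⊆ ·) C →
    (∀ A ∈ C, lam A ≤ (k : ℕ∞)) → lam (⋃₀ C) ≤ (k : ℕ∞)

/-- `P` is a partition of the ground set into (indexed) nonempty pairwise disjoint classes. -/
def IsPartitionInd {E : Type*} {ι : Type*} (P : ι → Set E) : Prop :=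
  (∀ i, (P i).Nonempty) ∧ (∀ i j, i ≠ j → Disjoint (P i) (P j)) ∧ (⋃ i, P i) = univ

/-- A subset `J` of a cyclically ordered set is an interval if one cannot find a cyclically
alternating quadruple `a, b, c, d` with `a, c ∈ J` and `b, d ∉ J`. -/
def IsCyclicInterval {ι : Type*} (c : CircularOrder ι) (J : Set ι) : Prop :=
  ¬ ∃ a b x d : ι, a ∈ J ∧ x ∈ J ∧ b ∉ J ∧ d ∉ J ∧ c.sbtw a b x ∧ c.sbtw x d a

/-- A `k`-pseudoflower: a partition with cyclically ordered index set such that the union of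
every interval of petals has connectivity at most `k - 1`. -/
def IsPseudoflower {E : Type*} {ι : Type*} (lam : Set E → ℕ∞) (k : ℕ)
    (c : CircularOrder ι) (P : ι → Set E) : Prop :=
  IsPartitionInd P ∧
    ∀ J : Set ι, IsCyclicInterval c J → J.Nonempty → J ≠ univ →
      lam (⋃ i ∈ J, P i) ≤ ((k - 1 : ℕ) : ℕ∞)

/-- The canonical cyclic order on `Fin n`, coming from its linear order. -/
noncomputable def finCirc (n : ℕ) : CircularOrder (Fin n) := LinearOrder.toCircularOrder (Fin n)

/-- A finite `k`-anemone: a partition into at least four petals such that every union of a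
nonempty proper subset of the petals has connectivity exactly `k - 1`. -/
def IsFinAnemone {E : Type*} (lam : Set E → ℕ∞) (k n : ℕ) (P : Fin n → Set E) : Prop :=
  4 ≤ n ∧ IsPartitionInd P ∧
    ∀ T : Set (Fin n), T.Nonempty → T ≠ univ → lam (⋃ i ∈ T, P i) = ((k - 1 : ℕ) : ℕ∞)

/-- `f` exhibits the partition `Q` (cyclically ordered by `cQ`) as a concatenation of the
partition `P` (cyclically ordered by `cP`): each petal of `P` is contained in the corresponding
petal of `Q`, and preimages of intervals are intervals. -/
def IsConcatMap {E : Type*} {ι κ : Type*} (cP : CircularOrder ι) (cQ : CircularOrder κ)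
    (P : ι → Set E) (Q : κ → Set E) (f : ι → κ) : Prop :=
  (∀ i, P i ⊆ Q (f i)) ∧
    ∀ T : Set κ, IsCyclicInterval cQ T → IsCyclicInterval cP (f ⁻¹' T)

/-- The axioms of a strict cyclic order, as needed below. -/
structure CycRel {ι : Type*} (s : ι → ι → ι → Prop) : Prop where
  rot : ∀ a b c, s a b c → s b c a
  asymm : ∀ a b c, s a b c → ¬ s c b a
  total : ∀ a b c, a ≠ b → b ≠ c → a ≠ c → s a b c ∨ s c b a
  trans : ∀ a b c d, s a b c → s a c d → s a b d

theorem CycRel.of {ι : Type*} (c : CircularOrder ι) : CycRel c.sbtw where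
  rot a b d h := by letI := c; exact SBtw.sbtw.cyclic_left h
  asymm a b d h := by letI := c; exact SBtw.sbtw.not_sbtw h
  total a b d h1 h2 h3 := by
    letI := c
    by_contra hh
    push Not at hh
    have h4 : btw d b a := by
      have := hh.1
      change ¬ sbtw a b d at this
      rwa [sbtw_iff_not_btw, not_not] at this
    have h5 : btw a b d := by
      have := hh.2
      change ¬ sbtw d b a at this
      rwa [sbtw_iff_not_btw, not_not] at this
    rcases Btw.btw.antisymm h5 h4 with h | h | h
    · exact h1 h
    · exact h2 h
    · exact h3 h.symm
  trans a b d e h1 h2 := by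
    letI := c
    have h3 : sbtw d e a := SBtw.sbtw.cyclic_left h2
    have h4 : sbtw b d a := SBtw.sbtw.cyclic_left h1
    have h5 : sbtw b e a := SBtw.sbtw.trans_left h4 h3
    exact SBtw.sbtw.cyclic_right h5

theorem CycRel.flip {ι : Type*} {s : ι → ι → ι → Prop} (h : CycRel s) :
    CycRel (fun a b c => s c b a) where
  rot a b c h1 := h.rot _ _ _ (h.rot _ _ _ h1)
  asymm a b c h1 := h.asymm _ _ _ h1
  total a b c h1 h2 h3 := (h.total a b c h1 h2 h3).symm
  trans a b c d h1 h2 := by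
    have := h.rot; have := h.trans
    grind

def IntRel {ι : Type*} (s : ι → ι → ι → Prop) (J : Set ι) : Prop :=
  ∀ a b x d : ι, a ∈ J → x ∈ J → b ∉ J → d ∉ J → s a b x → s x d a → False

theorem CycRel.irr {ι : Type*} {s : ι → ι → ι → Prop} (h : CycRel s) {a b c : ι}
    (h1 : s a b c) : a ≠ b ∧ b ≠ c ∧ a ≠ c := by
  have := h.rot; have := h.asymm
  refine ⟨?_, ?_, ?_⟩ <;> rintro rfl <;> grind

theorem CycRel.arc {ι : Type*} {s : ι → ι → ι → Prop} (h : CycRel s) (i x : ι) (hx : i ≠ x) :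
    IntRel s {z | ¬ s x z i} := by
  intro p b q d hp hq hb hd h1 h2
  simp only [mem_setOf_eq, not_not] at hp hq hb hd
  have hr := h.rot; have ha := h.asymm; have ht := h.total; have htr := h.trans
  have i1 := h.irr h1
  have i2 := h.irr h2
  have i3 := h.irr hb
  have i4 := h.irr hd
  clear h
  have key : ∀ p b, ¬ s x p i → s x b i → p ≠ i → s i p b := by
    intro p b hp hb hpi
    by_cases hpx : p = x <;> grind
  by_cases hpi : p = i
  · grind
  by_cases hqi : q = i
  · grind
  have := key p b hp hb hpi
  have := key q b hq hb hqi
  have := key p d hp hd hpi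
  have := key q d hq hd hqi
  rcases ht i p q (Ne.symm hpi) i1.2.2 (Ne.symm hqi) with h3 | h3
  · grind
  · grind

theorem CycRel.union {ι : Type*} {s : ι → ι → ι → Prop} (h : CycRel s) {A B : Set ι}
    (hA : IntRel s A) (hB : IntRel s B) {w : ι} (wA : w ∈ A) (wB : w ∈ B) :
    IntRel s (A ∪ B) := by
  have hr := h.rot; have ha := h.asymm; have ht := h.total; have htr := h.trans
  have key : ∀ {A B : Set ι}, IntRel s A → IntRel s B → w ∈ A → w ∈ B → ∀ p b q d,
      p ∈ A → q ∈ B → b ∉ A → b ∉ B → d ∉ A → d ∉ B → s p b q → s q d p → False := by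
    intro A B hA hB wA wB p b q d hp hq hb hb' hd hd' h1 h2
    have i1 := h.irr h1
    have i2 := h.irr h2
    have hwb : w ≠ b := fun e => hb (e ▸ wA)
    have hwd : w ≠ d := fun e => hd (e ▸ wA)
    have hbd : b ≠ d := by grind
    rcases ht b w d hwb.symm hwd hbd with h3 | h3
    · refine hA p b w d hp wA hb hd ?_ ?_
      · grind
      · grind
    · refine hB w b q d wB hq hb' hd' ?_ ?_
      · grind
      · grind
  intro p b q d hp hq hb hd h1 h2
  simp only [mem_union, not_or] at hp hq hb hd
  rcases hp with hp | hp <;> rcases hq with hq | hq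
  · exact hA p b q d hp hq hb.1 hd.1 h1 h2
  · exact key hA hB wA wB p b q d hp hq hb.1 hb.2 hd.1 hd.2 h1 h2
  · exact key hB hA wB wA p b q d hp hq hb.2 hb.1 hd.2 hd.1 h1 h2
  · exact hB p b q d hp hq hb.2 hd.2 h1 h2

theorem submod_inter {ι : Type*} {μ : Set ι → ℕ∞} (hsub : SubmodularFn μ) {m : ℕ} {A B C D : Set ι}
    (hA : μ A ≤ m) (hB : μ B ≤ m) (hC : A ∪ B = C) (hD : A ∩ B = D) (h : μ C = m) :
    μ D ≤ m := by
  have := hsub A B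
  rw [hC, hD, h] at this
  have h2 : (m : ℕ∞) + μ D ≤ m + m := this.trans (add_le_add hA hB)
  exact (ENat.add_le_add_iff_left (ENat.coe_ne_top m)).1 h2

theorem submod_union {ι : Type*} {μ : Set ι → ℕ∞} (hsub : SubmodularFn μ) {m : ℕ} {A B C D : Set ι}
    (hA : μ A ≤ m) (hB : μ B ≤ m) (hC : A ∪ B = C) (hD : A ∩ B = D) (h : μ D = m) :
    μ C ≤ m := by
  have := hsub A B
  rw [hC, hD, h, add_comm] at this
  have h2 : (m : ℕ∞) + μ C ≤ m + m := this.trans (add_le_add hA hB)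
  exact (ENat.add_le_add_iff_left (ENat.coe_ne_top m)).1 h2

theorem exists_fourth {n : ℕ} (hn : 4 ≤ n) (a b c : Fin n) : ∃ d, d ≠ a ∧ d ≠ b ∧ d ≠ c := by
  have : ({a, b, c} : Finset (Fin n)) ≠ Finset.univ := by
    intro h
    have h1 := congrArg Finset.card h
    have h2 := Finset.card_le_three (a := a) (b := b) (c := c)
    rw [Finset.card_univ, Fintype.card_fin] at h1
    omega
  rw [Ne, Finset.eq_univ_iff_forall] at this
  push Not at this
  obtain ⟨d, hd⟩ := this
  simp at hd
  exact ⟨d, by tauto⟩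

/-- The half of the fibre of `a` lying on one side of `i` has the upper bound. -/
theorem half_bound {ι : Type*} {s : ι → ι → ι → Prop} (h : CycRel s) {n m : ℕ} (hn : 4 ≤ n)
    (f : ι → Fin n) (hf : ∀ t, IntRel s (f ⁻¹' {t})) (hfs : Function.Surjective f)
    {μ : Set ι → ℕ∞} (hsub : SubmodularFn μ)
    (hI : ∀ J, IntRel s J → J.Nonempty → J ≠ univ → μ J ≤ m)
    (hT : ∀ T : Set (Fin n), T.Nonempty → T ≠ univ → μ (f ⁻¹' T) = m)
    (i : ι) (j : Fin n) (hj : j ≠ f i) (x0 : ι) (hx0 : f x0 ≠ f i) :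
    μ ({z | f z = f i ∧ ¬ s x0 z i} ∪ f ⁻¹' {j}) ≤ m := by
  have hr := h.rot; have ha := h.asymm; have ht := h.total; have htr := h.trans
  have indep1 : ∀ x y z, f x ≠ f i → f y ≠ f i → f z = f i → ¬ s x z i → ¬ s y z i := by
    intro x y z hx hy hz h1 h2
    have i1 := h.irr h2
    have hzx : z ≠ x := fun e => hx (e ▸ hz)
    have hix : i ≠ x := fun e => hx (e ▸ rfl)
    have h3 : s i z x := by
      rcases ht x z i hzx.symm i1.2.1 hix.symm with h | h
      · exact absurd h h1
      · exact h
    exact hf (f i) i y z x rfl hz hy hx (hr _ _ _ (hr _ _ _ (hr _ _ _ (by grind)))) (by grind)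
  have indep : ∀ x, f x ≠ f i →
      {z | f z = f i ∧ ¬ s x z i} = {z | f z = f i ∧ ¬ s x0 z i} := by
    intro x hx
    ext z
    constructor
    · rintro ⟨h1, h2⟩
      exact ⟨h1, indep1 x x0 z hx hx0 h1 h2⟩
    · rintro ⟨h1, h2⟩
      exact ⟨h1, indep1 x0 x z hx0 hx h1 h2⟩
  have core : ∀ x y, f x ≠ f i → f y ≠ f i → f x ≠ f y → s i x y →
      μ ({z | f z = f i ∧ ¬ s x0 z i} ∪ f ⁻¹' {f x}) ≤ m := by
    intro x y hx hy hxy hs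
    rw [← indep x hx]
    set J : Set ι := {z | ¬ s x z i} ∪ f ⁻¹' {f x} with hJ
    have i1 := h.irr hs
    have hJint : IntRel s J := by
      refine h.union (h.arc i x i1.1) (hf (f x)) (w := x) ?_ rfl
      intro h1
      exact (h.irr h1).1 rfl
    have hsy : s x y i := hr _ _ _ hs
    have hyJ : y ∉ J := by
      rintro (h1 | h1)
      · exact h1 hsy
      · exact hxy h1.symm
    have hJm : μ J ≤ m := hI J hJint ⟨x, Or.inr rfl⟩ (fun e => hyJ (e ▸ mem_univ y))
    -- fibres other than those of `a`, `f x` do not cross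
    have cross : ∀ z w, f z = f w → f z ≠ f i → f z ≠ f x → z ∈ J → w ∈ J := by
      intro z w hzw hz1 hz2 hzJ
      by_contra hw
      simp only [hJ, mem_union, mem_setOf_eq, mem_preimage, mem_singleton_iff, not_or, not_not]
        at hzJ hw
      have h1 : ¬ s x z i := by tauto
      have h2 : s i z x := by
        rcases ht x z i (fun e => hz2 (e ▸ rfl)) (fun e => hz1 (e ▸ rfl)) i1.1.symm with h | h
        · exact absurd h h1
        · exact h
      have h3 := hw.1
      exact hf (f z) z x w i rfl hzw.symm (fun e => hz2 e.symm) (fun e => hz1 e.symm)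
        (by grind) (by grind)
    have hpre : J ∪ f ⁻¹' {f i, f x} = f ⁻¹' (f '' J ∪ {f i, f x}) := by
      ext z
      simp only [mem_union, mem_preimage, mem_insert_iff, mem_singleton_iff, mem_image]
      constructor
      · rintro (h1 | h1)
        · exact Or.inl ⟨z, h1, rfl⟩
        · exact Or.inr h1
      · rintro (⟨w, h1, h2⟩ | h1)
        · by_cases h3 : f z = f i ∨ f z = f x
          · exact Or.inr h3
          · push Not at h3
            exact Or.inl (cross w z h2 (h2 ▸ h3.1) (h2 ▸ h3.2) h1)
        · exact Or.inr h1
    refine submod_inter hsub (A := J) (B := f ⁻¹' {f i, f x}) hJm ?_ hpre ?_ ?_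
    · refine (hT _ ⟨f i, by simp⟩ ?_).le
      intro e
      have : f y ∈ ({f i, f x} : Set (Fin n)) := e ▸ mem_univ _
      simp only [mem_insert_iff, mem_singleton_iff] at this
      rcases this with h1 | h1
      · exact hy h1
      · exact hxy h1.symm
    · ext z
      simp only [hJ, mem_union, mem_inter_iff, mem_preimage, mem_insert_iff, mem_singleton_iff,
        mem_setOf_eq]
      tauto
    · refine hT _ ⟨f i, by simp⟩ ?_
      intro e
      have : f y ∈ f '' J ∪ ({f i, f x} : Set (Fin n)) := e ▸ mem_univ _
      simp only [mem_union, mem_insert_iff, mem_singleton_iff, mem_image] at this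
      rcases this with ⟨w, h1, h2⟩ | h1 | h1
      · exact hyJ (cross w y h2 (h2 ▸ hy) (h2 ▸ hxy.symm) h1)
      · exact hy h1
      · exact hxy h1.symm
  obtain ⟨l, hl1, hl2, -⟩ := exists_fourth hn (f i) j j
  obtain ⟨x, rfl⟩ := hfs j
  obtain ⟨y, rfl⟩ := hfs l
  set R : Set ι := {z | f z = f i ∧ ¬ s x0 z i} with hR
  rcases ht i x y (fun e => hj (e ▸ rfl)) (fun e => hl2 (e ▸ rfl)) (fun e => hl1 (e ▸ rfl))
    with h1 | h1
  · exact core x y hj hl1 hl2.symm h1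
  · have h2 := core y x hl1 hj hl2 (by grind)
    obtain ⟨d, hd1, hd2, hd3⟩ := exists_fourth hn (f i) (f x) (f y)
    have pr : ∀ T : Set (Fin n), d ∉ T → T ≠ univ := fun T hd e => hd (e ▸ mem_univ d)
    have h3 : μ (R ∪ f ⁻¹' {f x, f y}) ≤ m := by
      refine submod_union hsub (A := R ∪ f ⁻¹' {f y}) (B := f ⁻¹' {f x, f y}) h2
        (hT _ ⟨f x, by simp⟩ (pr _ (by simp [hd2, hd3]))).le ?_ ?_
        (hT {f y} ⟨f y, by simp⟩ (pr _ (by simp [hd3])))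
      · ext z
        simp only [mem_union, mem_preimage, mem_insert_iff, mem_singleton_iff]
        tauto
      · ext z
        simp only [hR, mem_union, mem_inter_iff, mem_preimage, mem_insert_iff, mem_singleton_iff,
          mem_setOf_eq]
        grind
    refine submod_inter hsub (A := R ∪ f ⁻¹' {f x, f y}) (B := f ⁻¹' {f i, f x}) h3
        (hT _ ⟨f x, by simp⟩ (pr _ (by simp [hd1, hd2]))).le (C := f ⁻¹' {f i, f x, f y}) ?_ ?_
        (hT _ ⟨f y, by simp⟩ (pr _ (by simp [hd1, hd2, hd3])))
    · ext z
      simp only [hR, mem_union, mem_preimage, mem_insert_iff, mem_singleton_iff, mem_setOf_eq]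
      tauto
    · ext z
      simp only [hR, mem_union, mem_inter_iff, mem_preimage, mem_insert_iff, mem_singleton_iff,
        mem_setOf_eq]
      grind

theorem upper_bound {ι : Type*} {s : ι → ι → ι → Prop} (h : CycRel s) {n m : ℕ} (hn : 4 ≤ n)
    (f : ι → Fin n) (hf : ∀ t, IntRel s (f ⁻¹' {t})) (hfs : Function.Surjective f)
    {μ : Set ι → ℕ∞} (hsub : SubmodularFn μ)
    (hI : ∀ J, IntRel s J → J.Nonempty → J ≠ univ → μ J ≤ m)
    (hT : ∀ T : Set (Fin n), T.Nonempty → T ≠ univ → μ (f ⁻¹' T) = m)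
    (i : ι) (j : Fin n) (hj : j ≠ f i) :
    μ ({i} ∪ f ⁻¹' {j}) ≤ m := by
  obtain ⟨x, rfl⟩ := hfs j
  have hflip : ∀ J, IntRel s J ↔ IntRel (fun a b c => s c b a) J := by
    intro J
    constructor
    · intro hJ a b x d ha hx hb hd h1 h2
      exact hJ a d x b ha hx hd hb h2 h1
    · intro hJ a b x d ha hx hb hd h1 h2
      exact hJ a d x b ha hx hd hb h2 h1
  have h1 := half_bound h hn f hf hfs hsub hI hT i (f x) hj x hj
  have h2 := half_bound h.flip hn f (fun t => (hflip _).1 (hf t)) hfs hsub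
    (fun J hJ => hI J ((hflip J).2 hJ)) hT i (f x) hj x hj
  obtain ⟨d, hd1, hd2, -⟩ := exists_fourth hn (f i) (f x) (f x)
  have hix : i ≠ x := fun e => hj (e ▸ rfl)
  refine submod_inter hsub h1 h2 (C := f ⁻¹' {f i, f x}) ?_ ?_ (hT _ ⟨f x, by simp⟩ ?_)
  · ext z
    simp only [mem_union, mem_preimage, mem_insert_iff, mem_singleton_iff, mem_setOf_eq]
    have := h.asymm x z i
    tauto
  · ext z
    simp only [mem_union, mem_inter_iff, mem_preimage, mem_singleton_iff, mem_setOf_eq]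
    constructor
    · rintro ⟨⟨h3, h4⟩ | h3, ⟨h5, h6⟩ | h5⟩
      · left
        by_contra hz
        have hzx : z ≠ x := fun e => hj (e ▸ h3)
        rcases h.total x z i hzx.symm hz hix.symm with h | h
        · exact h4 h
        · exact h6 h
      · exact Or.inr h5
      · exact Or.inr h3
      · exact Or.inr h3
    · rintro (rfl | h3)
      · exact ⟨Or.inl ⟨rfl, fun e => (h.irr e).2.1 rfl⟩, Or.inl ⟨rfl, fun e => (h.irr e).1 rfl⟩⟩
      · exact ⟨Or.inr h3, Or.inr h3⟩
  · intro e
    have : d ∈ ({f i, f x} : Set (Fin n)) := e ▸ mem_univ _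
    simp [hd1, hd2] at this

theorem exact_value {ι : Type*} {s : ι → ι → ι → Prop} (h : CycRel s) {n m : ℕ} (hn : 4 ≤ n)
    (f : ι → Fin n) (hf : ∀ t, IntRel s (f ⁻¹' {t})) (hfs : Function.Surjective f)
    {μ : Set ι → ℕ∞} (hsub : SubmodularFn μ) (hsym : SymmFn μ)
    (hI : ∀ J, IntRel s J → J.Nonempty → J ≠ univ → μ J ≤ m)
    (hT : ∀ T : Set (Fin n), T.Nonempty → T ≠ univ → μ (f ⁻¹' T) = m)
    (i : ι) (j : Fin n) (hj : j ≠ f i) :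
    μ ({i} ∪ f ⁻¹' {j}) = m := by
  obtain ⟨l, hl1, hl2, -⟩ := exists_fourth hn (f i) j j
  have h1 := upper_bound h hn f hf hfs hsub hI hT i j hj
  have h2 := upper_bound h hn f hf hfs hsub hI hT i l hl1
  have h3 := hsub ({i} ∪ f ⁻¹' {j}) ({i} ∪ f ⁻¹' {l})ᶜ
  have e1 : ({i} ∪ f ⁻¹' {j}) ∪ ({i} ∪ f ⁻¹' {l})ᶜ = (f ⁻¹' {l})ᶜ := by
    ext z
    simp only [mem_union, mem_compl_iff, mem_preimage, mem_singleton_iff]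
    grind
  have e2 : ({i} ∪ f ⁻¹' {j}) ∩ ({i} ∪ f ⁻¹' {l})ᶜ = f ⁻¹' {j} := by
    ext z
    simp only [mem_union, mem_inter_iff, mem_compl_iff, mem_preimage, mem_singleton_iff]
    grind
  have pr : ∀ t : Fin n, t ≠ f i → ({t} : Set (Fin n)) ≠ univ := by
    intro t ht e
    have : f i ∈ ({t} : Set (Fin n)) := e ▸ mem_univ _
    exact ht this.symm
  rw [e1, e2, hsym, hsym, hT {l} ⟨l, rfl⟩ (pr l hl1), hT {j} ⟨j, rfl⟩ (pr j hj)] at h3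
  refine le_antisymm h1 ?_
  have h4 : (m : ℕ∞) + m ≤ μ ({i} ∪ f ⁻¹' {j}) + m := h3.trans (by gcongr)
  exact (ENat.add_le_add_iff_right (ENat.coe_ne_top m)).1 h4

/-- If a `k`-pseudoflower `P'` has a concatenation into a finite `k`-anemone `P`, then the union
of any petal of `P'` with any petal of `P` not containing it has connectivity exactly `k - 1`. -/
theorem stmt6 {E : Type*} {ι : Type*} (lam : Set E → ℕ∞)
    (hsym : SymmFn lam) (hsub : SubmodularFn lam) (hlim : LimitClosedFn lam)
    (k n : ℕ) (hk : 1 ≤ k) (c : CircularOrder ι) (P' : ι → Set E)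
    (hP' : IsPseudoflower lam k c P')
    (P : Fin n → Set E) (hP : IsFinAnemone lam k n P)
    (f : ι → Fin n) (hf : IsConcatMap c (finCirc n) P' P f)
    (i : ι) (j : Fin n) (hj : j ≠ f i) :
    lam (P' i ∪ P j) = ((k - 1 : ℕ) : ℕ∞) := by
  obtain ⟨hpart, hJ⟩ := hP'
  obtain ⟨hne', hdis', hcov'⟩ := hpart
  obtain ⟨hn, ⟨hne, hdis, hcov⟩, hA⟩ := hP
  obtain ⟨hsubs, hint⟩ := hf
  have hcv : ∀ e, ∃ y, e ∈ P' y := fun e => by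
    have : e ∈ ⋃ i, P' i := hcov' ▸ mem_univ e
    simpa using this
  have huniq : ∀ e y z, e ∈ P' y → e ∈ P' z → y = z := by
    intro e y z hy hz
    by_contra hyz
    exact Set.disjoint_left.1 (hdis' y z hyz) hy hz
  have hmem : ∀ e y t, e ∈ P' y → (e ∈ P t ↔ f y = t) := by
    intro e y t hy
    constructor
    · intro ht
      by_contra hyt
      exact Set.disjoint_left.1 (hdis _ _ hyt) (hsubs y hy) ht
    · rintro rfl
      exact hsubs y hy
  have hpre : ∀ T : Set (Fin n), (⋃ y ∈ f ⁻¹' T, P' y) = ⋃ t ∈ T, P t := by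
    intro T
    ext e
    simp only [mem_iUnion, mem_preimage, exists_prop]
    obtain ⟨y, hy⟩ := hcv e
    constructor
    · rintro ⟨z, hz, hez⟩
      exact ⟨f z, hz, hsubs z hez⟩
    · rintro ⟨t, ht, het⟩
      exact ⟨y, ((hmem e y t hy).1 het).symm ▸ ht, hy⟩
  have hfs : Function.Surjective f := by
    intro t
    obtain ⟨e, he⟩ := hne t
    obtain ⟨y, hy⟩ := hcv e
    exact ⟨y, (hmem e y t hy).1 he⟩
  have hI : ∀ J, IntRel c.sbtw J ↔ IsCyclicInterval c J := by
    intro J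
    unfold IntRel IsCyclicInterval
    constructor
    · rintro h ⟨a, b, x, d, h1, h2, h3, h4, h5, h6⟩
      exact h a b x d h1 h2 h3 h4 h5 h6
    · intro h a b x d h1 h2 h3 h4 h5 h6
      exact h ⟨a, b, x, d, h1, h2, h3, h4, h5, h6⟩
  have key := exact_value (CycRel.of c) (m := k - 1) hn f
    (fun t => (hI _).2 (hint _ (by
      rintro ⟨a, b, x, d, h1, h2, h3, h4, h5, h6⟩
      have : a = x := (mem_singleton_iff.1 h1).trans (mem_singleton_iff.1 h2).symm
      exact ((CycRel.of (finCirc n)).irr h5).2.2 this)))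
    hfs (μ := fun J => lam (⋃ y ∈ J, P' y))
    (by
      intro A B
      have h1 : (⋃ y ∈ A ∪ B, P' y) = (⋃ y ∈ A, P' y) ∪ ⋃ y ∈ B, P' y := biUnion_union _ _ _
      have h2 : (⋃ y ∈ A ∩ B, P' y) = (⋃ y ∈ A, P' y) ∩ ⋃ y ∈ B, P' y := by
        ext e
        simp only [mem_iUnion, mem_inter_iff, exists_prop]
        constructor
        · rintro ⟨y, ⟨h1, h2⟩, h3⟩
          exact ⟨⟨y, h1, h3⟩, ⟨y, h2, h3⟩⟩
        · rintro ⟨⟨y, h1, h2⟩, ⟨z, h3, h4⟩⟩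
          obtain rfl := huniq e y z h2 h4
          exact ⟨y, ⟨h1, h3⟩, h2⟩
      simp only [h1, h2]
      exact hsub _ _)
    (by
      intro A
      have h1 : (⋃ y ∈ Aᶜ, P' y) = (⋃ y ∈ A, P' y)ᶜ := by
        ext e
        obtain ⟨y, hy⟩ := hcv e
        simp only [mem_iUnion, mem_compl_iff, exists_prop]
        constructor
        · rintro ⟨z, h1, h2⟩ ⟨w, h3, h4⟩
          obtain rfl := huniq e z w h2 h4
          exact h1 h3
        · intro h
          exact ⟨y, fun h1 => h ⟨y, h1, hy⟩, hy⟩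
      simp only [h1]
      exact hsym _)
    (fun J hJi => hJ J ((hI J).1 hJi))
    (fun T h1 h2 => by
      simp only [hpre]
      exact hA T h1 h2)
    i j hj
  have hfin : (⋃ y ∈ ({i} ∪ f ⁻¹' {j} : Set ι), P' y) = P' i ∪ P j := by
    rw [biUnion_union, hpre]
    simp
  simp only [hfin] at key
  exact key
end

section
/- Let Φ' be a k-pseudoflower of a limit-closed connectivity system which can be concatenated into a finite k-anemone with at least k+1 petals. Then every union of petals of Φ' (not only unions of intervals) has connectivity at most k−1; that is, Φ' is a strong k-pseudoanemone. -/
open Set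

theorem enat_cancel {x y u v : ℕ∞} {K : ℕ} (h : x + y ≤ u + v) (hv : v ≤ K) (hy : (K : ℕ∞) ≤ y) :
    x ≤ u := by
  have h1 : x + (K : ℕ∞) ≤ u + (K : ℕ∞) :=
    (add_le_add_right hy x).trans (h.trans (add_le_add_right hv u))
  exact (ENat.add_le_add_iff_right (ENat.natCast_ne_top K)).1 h1

section Abstract

variable {ι : Type*} {n : ℕ} {mu : Set ι → ℕ∞} {K : ℕ} {f : ι → Fin n}

theorem exists_avoid (hn : 4 ≤ n) (a b c : Fin n) : ∃ d, d ≠ a ∧ d ≠ b ∧ d ≠ c := by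
  by_contra! h
  have h1 : (Finset.univ : Finset (Fin n)) ⊆ {a, b, c} := by
    intro d _
    have := h d
    simp only [Finset.mem_insert, Finset.mem_singleton]
    tauto
  have h2 := Finset.card_le_card h1
  have h3 : ({a, b, c} : Finset (Fin n)).card ≤ 3 := Finset.card_le_three
  simp at h2
  omega

theorem spread_one (hsub : SubmodularFn mu)
    (hA : ∀ T : Set (Fin n), T.Nonempty → T ≠ univ → mu (f ⁻¹' T) = K)
    {i j : Fin n} (hij : j ≠ i) {A : Set ι} (hAi : A ⊆ f ⁻¹' {i}) {s : ℕ∞}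
    (hs : mu (A ∪ f ⁻¹' {j}) ≤ s) (T : Set (Fin n)) (hiT : i ∉ T) (hjT : j ∈ T) :
    mu (A ∪ f ⁻¹' T) ≤ s := by
  have h := hsub (A ∪ f ⁻¹' {j}) (f ⁻¹' T)
  have e1 : A ∪ f ⁻¹' {j} ∪ f ⁻¹' T = A ∪ f ⁻¹' T := by
    ext x; simp only [mem_union, mem_preimage, mem_singleton_iff]; grind
  have e2 : (A ∪ f ⁻¹' {j}) ∩ f ⁻¹' T = f ⁻¹' {j} := by
    ext x
    have := @hAi x
    simp only [mem_union, mem_inter_iff, mem_preimage, mem_singleton_iff] at *; grind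
  rw [e1, e2] at h
  have hT : mu (f ⁻¹' T) = K := hA T ⟨j, hjT⟩ (fun h => hiT (h ▸ mem_univ i))
  have hj : mu (f ⁻¹' {j}) = K := hA {j} ⟨j, rfl⟩ (fun h => hij
    ((h ▸ mem_univ i : i ∈ ({j} : Set (Fin n))) ▸ rfl))
  exact (enat_cancel h hT.le hj.ge).trans hs

theorem spread_two (hsub : SubmodularFn mu)
    (hA : ∀ T : Set (Fin n), T.Nonempty → T ≠ univ → mu (f ⁻¹' T) = K)
    {i j : Fin n} (hij : j ≠ i) {A : Set ι} (hAi : A ⊆ f ⁻¹' {i}) {s : ℕ∞}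
    (hs : mu (A ∪ f ⁻¹' {j}) ≤ s) (T : Set (Fin n)) (hiT : i ∉ T) (hjT : j ∉ T)
    (l : Fin n) (hli : l ≠ i) (hlj : l ≠ j) (hlT : l ∉ T) :
    mu (A ∪ f ⁻¹' T) ≤ s := by
  have h0 := spread_one hsub hA hij hAi hs (insert j T) (by grind) (by grind)
  have h := hsub (A ∪ f ⁻¹' (insert j T)) (f ⁻¹' (insert i T))
  have e1 : A ∪ f ⁻¹' (insert j T) ∪ f ⁻¹' (insert i T) = f ⁻¹' (insert i (insert j T)) := by
    ext x
    have := @hAi x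
    simp only [mem_union, mem_preimage, mem_singleton_iff, mem_insert_iff] at *; grind
  have e2 : (A ∪ f ⁻¹' (insert j T)) ∩ f ⁻¹' (insert i T) = A ∪ f ⁻¹' T := by
    ext x
    have := @hAi x
    simp only [mem_union, mem_inter_iff, mem_preimage, mem_singleton_iff, mem_insert_iff] at *
    grind
  rw [e1, e2, add_comm] at h
  have h1 : mu (f ⁻¹' (insert i (insert j T))) = K := hA _ ⟨i, by simp⟩
    (fun h => by have := h ▸ mem_univ l; simp at this; tauto)
  have h2 : mu (f ⁻¹' (insert i T)) = K := hA _ ⟨i, by simp⟩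
    (fun h => by have := h ▸ mem_univ l; simp at this; tauto)
  exact (enat_cancel h h2.le h1.ge).trans h0

theorem spread (hn : 4 ≤ n) (hsub : SubmodularFn mu)
    (hA : ∀ T : Set (Fin n), T.Nonempty → T ≠ univ → mu (f ⁻¹' T) = K)
    {i j : Fin n} (hij : j ≠ i) {A : Set ι} (hAi : A ⊆ f ⁻¹' {i}) {s : ℕ∞}
    (hs : mu (A ∪ f ⁻¹' {j}) ≤ s) (T : Set (Fin n)) (hT : T.Nonempty) (hiT : i ∉ T) :
    mu (A ∪ f ⁻¹' T) ≤ s := by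
  by_cases hjT : j ∈ T
  · exact spread_one hsub hA hij hAi hs T hiT hjT
  · obtain ⟨l, hl⟩ := hT
    obtain ⟨d, hd1, hd2, hd3⟩ := exists_avoid hn i j l
    have h := spread_two hsub hA hij hAi hs {l} (by grind) (by grind) d hd1 hd2 (by simpa using hd3)
    exact spread_one hsub hA (by grind) hAi h T hiT hl

theorem lower (hn : 4 ≤ n) (hsym : SymmFn mu) (hsub : SubmodularFn mu)
    (hA : ∀ T : Set (Fin n), T.Nonempty → T ≠ univ → mu (f ⁻¹' T) = K)
    {i j : Fin n} (hij : j ≠ i) {A : Set ι} (hAi : A ⊆ f ⁻¹' {i}) :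
    (K : ℕ∞) ≤ mu (A ∪ f ⁻¹' {j}) := by
  by_contra! hlt
  obtain ⟨l, hli, hlj, -⟩ := exists_avoid hn i j j
  have hl := spread hn hsub hA hij hAi le_rfl {l} ⟨l, rfl⟩ (by grind)
  have h := hsub (A ∪ f ⁻¹' {j}) (A ∪ f ⁻¹' {l})ᶜ
  have e1 : (A ∪ f ⁻¹' {j}) ∪ (A ∪ f ⁻¹' {l})ᶜ = (f ⁻¹' {l})ᶜ := by
    ext x
    have := @hAi x
    simp only [mem_union, mem_compl_iff, mem_preimage, mem_singleton_iff] at *; grind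
  have e2 : (A ∪ f ⁻¹' {j}) ∩ (A ∪ f ⁻¹' {l})ᶜ = f ⁻¹' {j} := by
    ext x
    have := @hAi x
    simp only [mem_union, mem_inter_iff, mem_compl_iff, mem_preimage, mem_singleton_iff] at *
    grind
  rw [e1, e2, hsym, hsym] at h
  have h1 : mu (f ⁻¹' {l}) = K := hA _ ⟨l, rfl⟩
    (fun h => by have := h ▸ mem_univ i; simp at this; grind)
  have h2 : mu (f ⁻¹' {j}) = K := hA _ ⟨j, rfl⟩
    (fun h => by have := h ▸ mem_univ i; simp at this; grind)
  rw [h1, h2] at h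
  exact absurd (enat_cancel h (hl.trans hlt.le) le_rfl) (not_le.2 hlt)

theorem good_union (hn : 4 ≤ n) (hsym : SymmFn mu) (hsub : SubmodularFn mu)
    (hA : ∀ T : Set (Fin n), T.Nonempty → T ≠ univ → mu (f ⁻¹' T) = K)
    {i j : Fin n} (hij : j ≠ i) {A B : Set ι} (hAi : A ⊆ f ⁻¹' {i}) (hBi : B ⊆ f ⁻¹' {i})
    (h1 : mu (A ∪ f ⁻¹' {j}) ≤ K) (h2 : mu (B ∪ f ⁻¹' {j}) ≤ K) :
    mu ((A ∪ B) ∪ f ⁻¹' {j}) ≤ K ∧ mu ((A ∩ B) ∪ f ⁻¹' {j}) ≤ K := by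
  have h := hsub (A ∪ f ⁻¹' {j}) (B ∪ f ⁻¹' {j})
  rw [← union_union_distrib_right, ← inter_union_distrib_right] at h
  have l1 := lower hn hsym hsub hA hij (union_subset hAi hBi)
  have l2 := lower hn hsym hsub hA hij (inter_subset_left.trans hAi : A ∩ B ⊆ _)
  refine ⟨(enat_cancel h h2 l2).trans h1, ?_⟩
  rw [add_comm (mu _)] at h
  exact (enat_cancel h h2 l1).trans h1

theorem good_all (hn : 4 ≤ n) (hsym : SymmFn mu) (hsub : SubmodularFn mu) (hlim : LimitClosedFn mu)
    (hA : ∀ T : Set (Fin n), T.Nonempty → T ≠ univ → mu (f ⁻¹' T) = K)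
    {i j : Fin n} (hij : j ≠ i)
    (hsing : ∀ a, f a = i → mu ({a} ∪ f ⁻¹' {j}) ≤ K) (S : Set ι) (hS : S ⊆ f ⁻¹' {i}) :
    mu (S ∪ f ⁻¹' {j}) ≤ K := by
  have h2 : mu (f ⁻¹' {j}) = K := hA _ ⟨j, rfl⟩
    (fun h => by have := h ▸ mem_univ i; simp at this; grind)
  obtain ⟨M, hM⟩ := zorn_subset {M : Set ι | M ⊆ S ∧ mu (M ∪ f ⁻¹' {j}) ≤ K} (by
    intro C hC hch
    rcases C.eq_empty_or_nonempty with rfl | hne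
    · exact ⟨∅, ⟨empty_subset _, by simp [h2]⟩, by simp⟩
    · refine ⟨⋃₀ C, ⟨sUnion_subset fun s hs => (hC hs).1, ?_⟩, fun s hs => subset_sUnion_of_mem hs⟩
      have := hlim K ((fun M => M ∪ f ⁻¹' {j}) '' C) (hne.image _) (by
        rintro _ ⟨a, ha, rfl⟩ _ ⟨b, hb, rfl⟩ _
        rcases hch.total ha hb with h | h
        · exact Or.inl (union_subset_union_left _ h)
        · exact Or.inr (union_subset_union_left _ h)) (by
        rintro _ ⟨a, ha, rfl⟩
        exact (hC ha).2)
      convert this using 2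
      obtain ⟨c0, hc0⟩ := hne
      ext x
      simp only [mem_union, mem_sUnion, mem_image, exists_exists_and_eq_and]
      grind)
  have hMS : M = S := by
    refine hM.prop.1.antisymm fun x hx => ?_
    have h3 := (good_union hn hsym hsub hA hij (hM.prop.1.trans hS)
      (singleton_subset_iff.2 (hS hx)) hM.prop.2 (hsing x (hS hx))).1
    exact hM.le_of_ge ⟨union_subset hM.prop.1 (singleton_subset_iff.2 hx), h3⟩
      subset_union_left (Or.inr rfl)
  exact hMS ▸ hM.prop.2

theorem empty_le (hsym : SymmFn mu) (hsub : SubmodularFn mu) (A : Set ι) : mu ∅ ≤ mu A := by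
  have h := hsub A Aᶜ
  rw [union_compl_self, inter_compl_self, hsym, ← compl_empty, hsym] at h
  by_contra! hlt
  exact absurd h (not_le.2 (ENat.add_lt_add hlt hlt))

theorem one_full (hsym : SymmFn mu) (hsub : SubmodularFn mu) 
    (hA : ∀ T : Set (Fin n), T.Nonempty → T ≠ univ → mu (f ⁻¹' T) = K) (hn : 4 ≤ n)
    (hG : ∀ i (S : Set ι), S ⊆ f ⁻¹' {i} → ∀ T : Set (Fin n), T.Nonempty → i ∉ T →
      mu (S ∪ f ⁻¹' T) ≤ K) (X : Set ι) (T : Set (Fin n)) (hT : T.Nonempty)  :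
    mu (X ∪ f ⁻¹' T) ≤ K := by
  by_cases hTu : T = univ
  · subst hTu
    rw [preimage_univ, union_univ, ← compl_empty, hsym]
    refine (empty_le hsym hsub (f ⁻¹' {⟨0, by omega⟩})).trans (hA {⟨0, by omega⟩} ⟨_, rfl⟩ fun h => ?_).le
    have := h ▸ mem_univ (⟨1, by omega⟩ : Fin n)
    simp at this
  · have key : ∀ S : Finset (Fin n), (∀ i ∈ S, i ∉ T) →
        mu ((X ∩ f ⁻¹' (S : Set (Fin n))) ∪ f ⁻¹' T) ≤ K := by
      intro S
      induction S using Finset.induction_on with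
      | empty => intro _; simp [hA T hT hTu]
      | insert i S hi ih =>
        intro hS
        have h1 := ih (fun j hj => hS j (Finset.mem_insert_of_mem hj))
        have h2 := hG i (X ∩ f ⁻¹' {i}) inter_subset_right T hT (hS i (Finset.mem_insert_self _ _))
        have h := hsub ((X ∩ f ⁻¹' (S : Set (Fin n))) ∪ f ⁻¹' T) ((X ∩ f ⁻¹' {i}) ∪ f ⁻¹' T)
        have e1 : ((X ∩ f ⁻¹' (S : Set (Fin n))) ∪ f ⁻¹' T) ∪ ((X ∩ f ⁻¹' {i}) ∪ f ⁻¹' T) =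
            (X ∩ f ⁻¹' ((insert i S : Finset (Fin n)) : Set (Fin n))) ∪ f ⁻¹' T := by
          ext x
          simp only [mem_union, mem_inter_iff, mem_preimage, mem_singleton_iff, Finset.mem_coe,
            Finset.mem_insert]
          tauto
        have e2 : ((X ∩ f ⁻¹' (S : Set (Fin n))) ∪ f ⁻¹' T) ∩ ((X ∩ f ⁻¹' {i}) ∪ f ⁻¹' T) =
            f ⁻¹' T := by
          ext x
          simp only [mem_union, mem_inter_iff, mem_preimage, mem_singleton_iff, Finset.mem_coe]
          grind
        rw [e1, e2] at h
        exact (enat_cancel h h2 (hA T hT hTu).ge).trans h1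
    classical
    have := key (Finset.univ.filter (· ∉ T)) (by simp)
    convert this using 2
    ext x
    simp
    tauto

theorem final_bound (hsub : SubmodularFn mu) (hKn : K + 2 ≤ n)
    (hF : ∀ (X : Set ι) (T : Set (Fin n)), T.Nonempty → mu (X ∪ f ⁻¹' T) ≤ K) (X : Set ι) :
    mu X ≤ K := by
  by_contra! hlt
  have hge : ((K + 1 : ℕ) : ℕ∞) ≤ mu X := by
    push_cast
    exact Order.add_one_le_of_lt hlt
  have key : ∀ S : Finset (Fin n), S.Nonempty →
      mu (X ∪ f ⁻¹' (S : Set (Fin n))) + (S.card : ℕ∞) ≤ ((K + 1 : ℕ) : ℕ∞) := by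
    intro S hS
    induction hS using Finset.Nonempty.cons_induction with
    | singleton a =>
      have := hF X {a} ⟨a, rfl⟩
      simp only [Finset.coe_singleton, Finset.card_singleton]
      push_cast
      gcongr
    | cons a S ha hS ih =>
      have h := hsub (X ∪ f ⁻¹' (S : Set (Fin n))) (X ∪ f ⁻¹' {a})
      have e1 : (X ∪ f ⁻¹' (S : Set (Fin n))) ∪ (X ∪ f ⁻¹' {a}) =
          X ∪ f ⁻¹' ((Finset.cons a S ha : Finset (Fin n)) : Set (Fin n)) := by
        ext x
        simp only [mem_union, mem_preimage, mem_singleton_iff, Finset.mem_coe, Finset.mem_cons]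
        tauto
      have e2 : (X ∪ f ⁻¹' (S : Set (Fin n))) ∩ (X ∪ f ⁻¹' {a}) = X := by
        ext x
        simp only [mem_union, mem_inter_iff, mem_preimage, mem_singleton_iff, Finset.mem_coe]
        grind
      rw [e1, e2] at h
      have h1 := hF X {a} ⟨a, rfl⟩
      have h2 : mu (X ∪ f ⁻¹' ((Finset.cons a S ha : Finset (Fin n)) : Set (Fin n))) + 1 ≤
          mu (X ∪ f ⁻¹' (S : Set (Fin n))) := by
        have h3 := (add_le_add_right hge _).trans (h.trans (add_le_add_right h1 _))
        push_cast at h3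
        rw [add_comm (K : ℕ∞) 1, ← add_assoc] at h3
        exact (ENat.add_le_add_iff_right (ENat.natCast_ne_top K)).1 h3
      rw [Finset.card_cons]
      push_cast at ih ⊢
      calc _ = mu (X ∪ f ⁻¹' ((Finset.cons a S ha : Finset (Fin n)) : Set (Fin n))) + 1
                + (S.card : ℕ∞) := by push_cast; ring
        _ ≤ mu (X ∪ f ⁻¹' (S : Set (Fin n))) + (S.card : ℕ∞) := by gcongr
        _ ≤ _ := ih
  have h := key Finset.univ ⟨⟨0, by omega⟩, Finset.mem_univ _⟩
  have h' := le_add_self.trans h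
  simp only [Finset.card_univ, Fintype.card_fin, Nat.cast_le] at h'
  omega

set_option maxHeartbeats 1000000 in
theorem arc_good {R : ι → ι → ι → Prop} (cyc : ∀ {a b c}, R a b c → R b c a)
    (asy : ∀ {a b c}, R a b c → ¬ R c b a) (tr : ∀ {a b c d}, R a b c → R a c d → R a b d)
    (tot : ∀ {a b c}, a ≠ b → b ≠ c → a ≠ c → R a b c ∨ R c b a)
    (hsub : SubmodularFn mu)
    (hA : ∀ T : Set (Fin n), T.Nonempty → T ≠ univ → mu (f ⁻¹' T) = K)
    (hI : ∀ J : Set ι, (¬ ∃ a b x d : ι, a ∈ J ∧ x ∈ J ∧ b ∉ J ∧ d ∉ J ∧ R a b x ∧ R x d a) →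
      J.Nonempty → J ≠ univ → mu J ≤ K)
    {i j s p : Fin n} (hji : j ≠ i) (hsi : s ≠ i) (hpi : p ≠ i) (hjs : j ≠ s) (hjp : j ≠ p)
    (hsp : s ≠ p)
    (h1 : ∀ l a b x d, f a = l → f x = l → f b ≠ l → f d ≠ l → R a b x → R x d a → False)
    (hs : ∀ a b x d, (f a = i ∨ f a = s) → (f x = i ∨ f x = s) → ¬ (f b = i ∨ f b = s) →
      ¬ (f d = i ∨ f d = s) → R a b x → R x d a → False)
    (hp : ∀ a b x d, (f a = i ∨ f a = p) → (f x = i ∨ f x = p) → ¬ (f b = i ∨ f b = p) →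
      ¬ (f d = i ∨ f d = p) → R a b x → R x d a → False)
    {a b xs xp : ι} (ha : f a = i) (hb : f b = j) (hxs : f xs = s) (hxp : f xp = p) :
    mu ({x | f x = i ∧ (x = a ∨ R b x a)} ∪ f ⁻¹' {j}) ≤ K := by
  have irr1 : ∀ {x y}, ¬ R x y x := fun h => asy h h
  have irr2 : ∀ {x y}, ¬ R x x y := fun h => irr1 (cyc h)
  have irr3 : ∀ {x y}, ¬ R y x x := fun h => irr2 (cyc h)
  have comb : ∀ {a u v w}, R a u v → R a v w → R u v w :=
    fun h h' => cyc (cyc (tr (cyc h') (cyc (cyc h))))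
  have lin : ∀ {x y z}, R x y z → x ≠ a → y ≠ a → z ≠ a →
      (R a x y ∧ R a y z) ∨ (R a y z ∧ R a z x) ∨ (R a z x ∧ R a x y) := by
    intro x y z h hx hy hz
    have hxy : x ≠ y := by rintro rfl; exact irr2 h
    have hyz : y ≠ z := by rintro rfl; exact irr3 h
    have hxz : x ≠ z := by rintro rfl; exact irr1 h
    have t : ∀ u v, u ≠ v → u ≠ a → v ≠ a → R a u v ∨ R a v u := by
      intro u v h1 h2 h3
      rcases tot (Ne.symm h2) h1 (Ne.symm h3) with h | h
      · exact Or.inl h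
      · exact Or.inr (cyc (cyc h))
    have n1 : ¬ (R a z y ∧ R a y x) := fun h' => asy h (comb h'.1 h'.2)
    have n2 : ¬ (R a x z ∧ R a z y) := fun h' => asy h (cyc (comb h'.1 h'.2))
    have n3 : ¬ (R a y x ∧ R a x z) := fun h' => asy h (cyc (cyc (comb h'.1 h'.2)))
    rcases t x y hxy hx hy with h1 | h1 <;> rcases t y z hyz hy hz with h2 | h2 <;>
      rcases t x z hxz hx hz with h3 | h3 <;> tauto
  set J : Set ι := {x | f x = j ∨ R b x a ∨ x = a} with hJ
  have hbJ : b ∈ J := Or.inl hb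
  have hab : a ≠ b := by rintro rfl; exact hji (hb.symm.trans ha)
  have hout : ∀ x, x ∉ J → f x ≠ j ∧ x ≠ a ∧ x ≠ b ∧ R a x b := by
    intro x hx
    simp only [hJ, mem_ofPred_eq, not_or] at hx
    have hxb : x ≠ b := by rintro rfl; exact hx.1 hb
    refine ⟨hx.1, hx.2.2, hxb, ?_⟩
    rcases tot (a := a) (b := x) (c := b) (Ne.symm hx.2.2) hxb hab with h | h
    · exact h
    · exact absurd h hx.2.1
  have aux : ∀ p q r t, f p = j → (r = a ∨ R b r a) → q ∉ J → t ∉ J → R p q r → R r t p →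
      False := by
    intro p q r t hpj hr hq ht h2 h3
    obtain ⟨hq1, hq2, hq3, hq4⟩ := hout q hq
    obtain ⟨ht1, ht2, ht3, ht4⟩ := hout t ht
    have hpa : p ≠ a := by rintro rfl; exact hji (hpj.symm.trans ha)
    have hpq : R a p q ∧ R a t p := by
      by_cases hra : r = a
      · subst hra
        exact ⟨cyc (cyc h2), h3⟩
      · have hbr : R a b r := cyc (cyc (hr.resolve_left hra))
        have hqr := tr hq4 hbr
        have htr := tr ht4 hbr
        have asy' : ∀ {u v}, R a u v → ¬ R a v u := fun h h' => asy (cyc h) h'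
        have := asy' hqr
        have := asy' htr
        have := @asy' p r
        rcases lin h2 hpa hq2 hra with h | h | h <;> rcases lin h3 hra ht2 hpa with h' | h' | h' <;>
          tauto
    have hpb := tr hpq.1 hq4
    exact h1 j p q b t hpj hb hq1 ht1 (comb hpq.1 hq4) (cyc (cyc (comb hpq.2 hpb)))
  have hJint : ¬ ∃ a b x d : ι, a ∈ J ∧ x ∈ J ∧ b ∉ J ∧ d ∉ J ∧ R a b x ∧ R x d a := by
    rintro ⟨p, q, r, t, hp', hr', hq, ht, h2, h3⟩
    obtain ⟨hq1, hq2, hq3, hq4⟩ := hout q hq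
    obtain ⟨ht1, ht2, ht3, ht4⟩ := hout t ht
    by_cases hpj : f p = j
    · by_cases hrj : f r = j
      · exact h1 j p q r t hpj hrj hq1 ht1 h2 h3
      · exact aux p q r t hpj (by simp only [hJ, mem_ofPred_eq] at hr'; tauto) hq ht h2 h3
    · by_cases hrj : f r = j
      · exact aux r t p q hrj (by simp only [hJ, mem_ofPred_eq] at hp'; tauto) ht hq h3 h2
      · have asy' : ∀ {u v}, R a u v → ¬ R a v u := fun h h' => asy (cyc h) h'
        have hp2 : p ≠ a → R a b p := fun h => by
          simp only [hJ, mem_ofPred_eq] at hp'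
          exact cyc (cyc ((hp'.resolve_left hpj).resolve_right h))
        have hr2 : r ≠ a → R a b r := fun h => by
          simp only [hJ, mem_ofPred_eq] at hr'
          exact cyc (cyc ((hr'.resolve_left hrj).resolve_right h))
        by_cases hpa : p = a
        · have hra : r ≠ a := by rintro rfl; subst hpa; exact irr1 h2
          have h4 := tr ht4 (hr2 hra)
          rw [hpa] at h3
          exact asy' h4 (cyc (cyc h3))
        · by_cases hra : r = a
          · rw [hra] at h2
            exact asy' (tr hq4 (hp2 hpa)) (cyc (cyc h2))
          · have k1 := asy' (tr hq4 (hp2 hpa))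
            have k2 := asy' (tr ht4 (hp2 hpa))
            have k3 := asy' (tr hq4 (hr2 hra))
            have k4 := asy' (tr ht4 (hr2 hra))
            have := @asy' p r
            rcases lin h2 hpa hq2 hra with h | h | h <;>
              rcases lin h3 hra ht2 hpa with h' | h' | h' <;> tauto
  have hmiss : ∃ z, z ∉ J ∧ f z ≠ i := by
    by_contra! hno
    have hxsa : a ≠ xs := fun h => hsi (hxs.symm.trans (h ▸ ha))
    have hxpa : a ≠ xp := fun h => hpi (hxp.symm.trans (h ▸ ha))
    have hxx : xs ≠ xp := fun h => hsp (hxs.symm.trans (h ▸ hxp))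
    have hs1 : R a b xs := by
      by_contra hc
      refine hsi (hxs.symm.trans (hno xs ?_))
      simp only [hJ, mem_ofPred_eq, not_or]
      exact ⟨fun h => hjs (h.symm.trans hxs), fun h => hc (cyc (cyc h)), fun h => hxsa h.symm⟩
    have hp1 : R a b xp := by
      by_contra hc
      refine hpi (hxp.symm.trans (hno xp ?_))
      simp only [hJ, mem_ofPred_eq, not_or]
      exact ⟨fun h => hjp (h.symm.trans hxp), fun h => hc (cyc (cyc h)), fun h => hxpa h.symm⟩
    rcases tot (a := a) (b := xs) (c := xp) hxsa hxx hxpa with h | h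
    · exact hs a b xs xp (Or.inl ha) (Or.inr hxs) (by rw [hb]; exact not_or.2 ⟨hji, hjs⟩)
        (by rw [hxp]; exact not_or.2 ⟨hpi, hsp.symm⟩) hs1 (cyc h)
    · exact hp a b xp xs (Or.inl ha) (Or.inr hxp) (by rw [hb]; exact not_or.2 ⟨hji, hjp⟩)
        (by rw [hxs]; exact not_or.2 ⟨hsi, hsp⟩) hp1 h
  have hwhole : ∀ x y, f x ≠ i → f x = f y → x ∈ J → y ∈ J := by
    intro x y hxi hxy hx
    by_contra hy
    obtain ⟨hy1, hy2, hy3, hy4⟩ := hout y hy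
    have hbx : R a b x := by
      simp only [hJ, mem_ofPred_eq] at hx
      rcases hx with h | h | h
      · exact absurd (hxy.symm.trans h) hy1
      · exact cyc (cyc h)
      · exact absurd (h ▸ ha) hxi
    exact h1 (f x) y b x a hxy.symm rfl (fun h => hy1 (hxy.symm.trans (h.symm.trans hb)))
      (fun h => hxi (h.symm.trans ha)) (comb hy4 hbx)
      (cyc (cyc (tr hy4 hbx)))
  clear aux lin comb irr1 irr2 irr3 hout h1 hs hp
  obtain ⟨z, hzJ, hzi⟩ := hmiss
  have hmJ := hI J hJint ⟨b, hbJ⟩ (fun h => hzJ (h ▸ mem_univ z))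
  have h := hsub J (f ⁻¹' {i, j})
  have e1 : J ∪ f ⁻¹' {i, j} = f ⁻¹' {l | l = i ∨ ∃ x ∈ J, f x = l} := by
    ext x
    simp only [mem_union, mem_preimage, mem_insert_iff, mem_singleton_iff, mem_ofPred_eq]
    constructor
    · rintro (h | h | h)
      · exact Or.inr ⟨x, h, rfl⟩
      · exact Or.inl h
      · exact Or.inr ⟨b, hbJ, hb.trans h.symm⟩
    · rintro (h | ⟨y, hy, hyx⟩)
      · exact Or.inr (Or.inl h)
      · by_cases hxi : f x = i
        · exact Or.inr (Or.inl hxi)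
        · exact Or.inl (hwhole y x (hyx ▸ hxi) hyx hy)
  have e2 : J ∩ f ⁻¹' {i, j} = {x | f x = i ∧ (x = a ∨ R b x a)} ∪ f ⁻¹' {j} := by
    ext x
    simp only [hJ, mem_union, mem_inter_iff, mem_preimage, mem_insert_iff, mem_singleton_iff,
      mem_ofPred_eq]
    grind
  rw [e1, e2, add_comm (mu _)] at h
  have k1 : mu (f ⁻¹' {l | l = i ∨ ∃ x ∈ J, f x = l}) = K := hA _ ⟨i, Or.inl rfl⟩ (by
    intro h
    have := h ▸ mem_univ (f z)
    simp only [mem_ofPred_eq] at this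
    rcases this with h' | ⟨x, hx, hxz⟩
    · exact hzi h'
    · exact hzJ (hwhole x z (hxz ▸ hzi) hxz hx))
  have k2 : mu (f ⁻¹' {i, j}) = K := hA _ ⟨i, Or.inl rfl⟩ (by
    intro h
    have := h ▸ mem_univ s
    simp only [mem_insert_iff, mem_singleton_iff] at this
    rcases this with h' | h'
    · exact hsi h'
    · exact hjs h'.symm)
  exact (enat_cancel h k2.le k1.ge).trans hmJ

end Abstract

section CyclicFin

theorem pair_interval {n : ℕ} {i s : Fin n}
    (h : s.val = i.val + 1 ∨ (i.val + 1 = n ∧ s.val = 0)) :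
    IsCyclicInterval (finCirc n) {i, s} := by
  rintro ⟨a, b, x, d, ha, hx, hb, hd, h1, h2⟩
  have h1' : (a < b ∧ b < x) ∨ (b < x ∧ x < a) ∨ (x < a ∧ a < b) := h1
  have h2' : (x < d ∧ d < a) ∨ (d < a ∧ a < x) ∨ (a < x ∧ x < d) := h2
  simp only [mem_insert_iff, mem_singleton_iff, Fin.ext_iff, Fin.lt_def] at *
  have := b.isLt
  have := d.isLt
  omega

theorem single_interval {n : ℕ} (i : Fin n) : IsCyclicInterval (finCirc n) {i} := by
  rintro ⟨a, b, x, d, ha, hx, hb, hd, h1, h2⟩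
  have h1' : (a < b ∧ b < x) ∨ (b < x ∧ x < a) ∨ (x < a ∧ a < b) := h1
  simp only [mem_singleton_iff, Fin.ext_iff, Fin.lt_def] at *
  omega

end CyclicFin

theorem single_good {ι : Type*} {n : ℕ} {mu : Set ι → ℕ∞} {K : ℕ} {f : ι → Fin n}
    (c : CircularOrder ι) (hn : 4 ≤ n) (hsym : SymmFn mu) (hsub : SubmodularFn mu)
    (hA : ∀ T : Set (Fin n), T.Nonempty → T ≠ univ → mu (f ⁻¹' T) = K)
    (hI : ∀ J : Set ι, IsCyclicInterval c J → J.Nonempty → J ≠ univ → mu J ≤ K)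
    (hf : ∀ T, IsCyclicInterval (finCirc n) T → IsCyclicInterval c (f ⁻¹' T))
    (hsurj : Function.Surjective f) (i : Fin n) :
    ∃ j, j ≠ i ∧ ∀ a, f a = i → mu ({a} ∪ f ⁻¹' {j}) ≤ K := by
  obtain ⟨s, hs⟩ : ∃ s : Fin n, s.val = i.val + 1 ∨ (i.val + 1 = n ∧ s.val = 0) := by
    by_cases h : i.val + 1 = n
    · exact ⟨⟨0, by omega⟩, Or.inr ⟨h, rfl⟩⟩
    · exact ⟨⟨i.val + 1, by omega⟩, Or.inl rfl⟩
  obtain ⟨p, hp⟩ : ∃ p : Fin n, i.val = p.val + 1 ∨ (p.val + 1 = n ∧ i.val = 0) := by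
    by_cases h : i.val = 0
    · exact ⟨⟨n - 1, by omega⟩, Or.inr ⟨by simp only; omega, h⟩⟩
    · exact ⟨⟨i.val - 1, by omega⟩, Or.inl (by simp only; omega)⟩
  have hsi : s ≠ i := by intro h; rw [h] at hs; omega
  have hpi : p ≠ i := by intro h; rw [h] at hp; omega
  have hsp : s ≠ p := by intro h; rw [h] at hs; omega
  obtain ⟨j, hji, hjs, hjp⟩ := exists_avoid hn i s p
  refine ⟨j, hji, fun a ha => ?_⟩
  obtain ⟨b, hb⟩ := hsurj j
  obtain ⟨xs, hxs⟩ := hsurj s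
  obtain ⟨xp, hxp⟩ := hsurj p
  have I1 := fun l => hf {l} (single_interval l)
  have I2 := hf _ (pair_interval hs)
  have I3 := hf _ (pair_interval hp)
  rw [Set.pair_comm] at I3
  have cyc : ∀ {a b d : ι}, c.sbtw a b d → c.sbtw b d a := fun h => sbtw_cyclic_left h
  have asy : ∀ {a b d : ι}, c.sbtw a b d → ¬ c.sbtw d b a := fun h => sbtw_asymm h
  have tr : ∀ {a b d e : ι}, c.sbtw a b d → c.sbtw a d e → c.sbtw a b e :=
    fun h h' => sbtw_trans_right h h'
  have tot : ∀ {a b d : ι}, a ≠ b → b ≠ d → a ≠ d → c.sbtw a b d ∨ c.sbtw d b a := by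
    intro x y z h1 h2 h3
    by_contra! hcon
    have e1 : c.btw z y x := by
      by_contra h
      exact hcon.1 (sbtw_iff_not_btw.2 h)
    have e2 : c.btw x y z := by
      by_contra h
      exact hcon.2 (sbtw_iff_not_btw.2 h)
    rcases btw_antisymm e2 e1 with h | h | h
    · exact h1 h
    · exact h2 h
    · exact h3 h.symm
  have A1 := arc_good (R := fun a b d => c.sbtw a b d) cyc asy tr tot hsub hA hI
    hji hsi hpi hjs hjp hsp
    (fun l a b x d e1 e2 e3 e4 e5 e6 => I1 l ⟨a, b, x, d, e1, e2, e3, e4, e5, e6⟩)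
    (fun a b x d e1 e2 e3 e4 e5 e6 => I2 ⟨a, b, x, d, e1, e2, e3, e4, e5, e6⟩)
    (fun a b x d e1 e2 e3 e4 e5 e6 => I3 ⟨a, b, x, d, e1, e2, e3, e4, e5, e6⟩)
    ha hb hxs hxp
  have A2 := arc_good (R := fun a b d => c.sbtw d b a)
    (fun h => cyc (cyc h)) asy (fun h h' => cyc (tr (cyc (cyc h')) (cyc (cyc h))))
    (fun h1 h2 h3 => (tot h1 h2 h3).symm) hsub hA
    (fun J h => hI J (fun ⟨a, b, x, d, e1, e2, e3, e4, e5, e6⟩ =>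
      h ⟨a, d, x, b, e1, e2, e4, e3, e6, e5⟩))
    hji hsi hpi hjs hjp hsp
    (fun l a b x d e1 e2 e3 e4 e5 e6 => I1 l ⟨a, d, x, b, e1, e2, e4, e3, e6, e5⟩)
    (fun a b x d e1 e2 e3 e4 e5 e6 => I2 ⟨a, d, x, b, e1, e2, e4, e3, e6, e5⟩)
    (fun a b x d e1 e2 e3 e4 e5 e6 => I3 ⟨a, d, x, b, e1, e2, e4, e3, e6, e5⟩)
    ha hb hxs hxp
  have := (good_union hn hsym hsub hA hji (fun x hx => hx.1) (fun x hx => hx.1) A1 A2).2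
  convert this using 3
  ext x
  simp only [mem_singleton_iff, mem_inter_iff, mem_ofPred_eq]
  constructor
  · rintro rfl
    exact ⟨⟨ha, Or.inl rfl⟩, ⟨ha, Or.inl rfl⟩⟩
  · rintro ⟨⟨-, h | h⟩, ⟨-, hh | hh⟩⟩
    · exact h
    · exact h
    · exact hh
    · exact absurd hh (asy h)

/-- A `k`-pseudoflower that can be concatenated into a finite `k`-anemone with at least `k + 1`
petals is a strong `k`-pseudoanemone: every union of petals has connectivity at most `k - 1`. -/
theorem stmt8 {E : Type*} {ι : Type*} (lam : Set E → ℕ∞)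
    (hsym : SymmFn lam) (hsub : SubmodularFn lam) (hlim : LimitClosedFn lam)
    (k n : ℕ) (hk : 1 ≤ k) (hn : k + 1 ≤ n) (c : CircularOrder ι) (P' : ι → Set E)
    (hP' : IsPseudoflower lam k c P')
    (P : Fin n → Set E) (hP : IsFinAnemone lam k n P)
    (f : ι → Fin n) (hf : IsConcatMap c (finCirc n) P' P f)
    (J : Set ι) :
    lam (⋃ i ∈ J, P' i) ≤ ((k - 1 : ℕ) : ℕ∞) := by
  obtain ⟨⟨hne, hdis, hcov⟩, hint⟩ := hP'
  obtain ⟨hn4, ⟨hPne, hPdis, hPcov⟩, hPA⟩ := hP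
  obtain ⟨hsubset, hfint⟩ := hf
  set mu : Set ι → ℕ∞ := fun S => lam (⋃ i ∈ S, P' i) with hmu
  have hcov' : ∀ e, ∃ i, e ∈ P' i := fun e => by
    have : e ∈ ⋃ i, P' i := hcov ▸ mem_univ e
    simpa using this
  have huniq : ∀ e i j, e ∈ P' i → e ∈ P' j → i = j := fun e i j h1 h2 => by
    by_contra h
    exact (Set.disjoint_left.1 (hdis i j h)) h1 h2
  have hPuniq : ∀ e i j, e ∈ P i → e ∈ P j → i = j := fun e i j h1 h2 => by
    by_contra h
    exact (Set.disjoint_left.1 (hPdis i j h)) h1 h2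
  have hpre : ∀ T : Set (Fin n), (⋃ i ∈ f ⁻¹' T, P' i) = ⋃ l ∈ T, P l := by
    intro T
    ext e
    simp only [mem_iUnion, mem_preimage, exists_prop]
    constructor
    · rintro ⟨i, hi, he⟩
      exact ⟨f i, hi, hsubset i he⟩
    · rintro ⟨l, hl, he⟩
      obtain ⟨i, hi⟩ := hcov' e
      have := hPuniq e _ _ (hsubset i hi) he
      exact ⟨i, this ▸ hl, hi⟩
  have hmsym : SymmFn mu := by
    intro A
    have : (⋃ i ∈ Aᶜ, P' i) = (⋃ i ∈ A, P' i)ᶜ := by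
      ext e
      simp only [mem_iUnion, mem_compl_iff, exists_prop, not_exists, not_and]
      constructor
      · rintro ⟨i, hi, he⟩ j hj he'
        exact hi (huniq e i j he he' ▸ hj)
      · intro h
        obtain ⟨i, hi⟩ := hcov' e
        exact ⟨i, fun h' => h i h' hi, hi⟩
    simp only [hmu, this]
    exact hsym _
  have hmsub : SubmodularFn mu := by
    intro A B
    have e1 : (⋃ i ∈ A ∪ B, P' i) = (⋃ i ∈ A, P' i) ∪ (⋃ i ∈ B, P' i) := biUnion_union _ _ _
    have e2 : (⋃ i ∈ A ∩ B, P' i) = (⋃ i ∈ A, P' i) ∩ (⋃ i ∈ B, P' i) := by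
      ext e
      simp only [mem_iUnion, mem_inter_iff, exists_prop]
      constructor
      · rintro ⟨i, ⟨hi, hi'⟩, he⟩
        exact ⟨⟨i, hi, he⟩, ⟨i, hi', he⟩⟩
      · rintro ⟨⟨i, hi, he⟩, ⟨j, hj, he'⟩⟩
        exact ⟨i, ⟨hi, huniq e j i he' he ▸ hj⟩, he⟩
    simp only [hmu, e1, e2]
    exact hsub _ _
  have hmlim : LimitClosedFn mu := by
    intro m C hC hch hb
    have := hlim m ((fun S => ⋃ i ∈ S, P' i) '' C) (hC.image _) (by
      rintro _ ⟨a, ha, rfl⟩ _ ⟨b, hb, rfl⟩ _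
      rcases hch.total ha hb with h | h
      · exact Or.inl (biUnion_subset_biUnion_left h)
      · exact Or.inr (biUnion_subset_biUnion_left h)) (by
      rintro _ ⟨a, ha, rfl⟩
      exact hb a ha)
    have e : (⋃ i ∈ ⋃₀ C, P' i) = ⋃₀ ((fun S => ⋃ i ∈ S, P' i) '' C) := by
      ext e
      simp only [mem_iUnion, mem_sUnion, exists_prop, mem_image, exists_exists_and_eq_and]
      grind
    simp only [hmu, e]
    exact this
  have hA : ∀ T : Set (Fin n), T.Nonempty → T ≠ univ → mu (f ⁻¹' T) = ((k - 1 : ℕ) : ℕ∞) := by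
    intro T h1 h2
    simp only [hmu, hpre]
    exact hPA T h1 h2
  have hsurj : Function.Surjective f := by
    intro l
    obtain ⟨e, he⟩ := hPne l
    obtain ⟨i, hi⟩ := hcov' e
    exact ⟨i, hPuniq e _ _ (hsubset i hi) he⟩
  have hG : ∀ i (S : Set ι), S ⊆ f ⁻¹' {i} → ∀ T : Set (Fin n), T.Nonempty → i ∉ T →
      mu (S ∪ f ⁻¹' T) ≤ ((k - 1 : ℕ) : ℕ∞) := by
    intro i S hS T hT hiT
    obtain ⟨j, hji, hj⟩ := single_good c hn4 hmsym hmsub hA hint hfint hsurj i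
    exact spread hn4 hmsub hA hji hS
      (good_all hn4 hmsym hmsub hmlim hA hji hj S hS) T hT hiT
  exact final_bound hmsub (by omega) (one_full hmsym hmsub hA hn4 hG) J
end
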